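/- Let a_D be the Darboux 1-form on ℝ², a_D(x,y)(v) = (1+x)·v₂, with vector field X_D(x,y) = (−(1+x), 0) spanning its kernel. Let k ≥ 0 be an integer and f a smooth function near 0 ∈ ℝ² with f(0,0) = 0, ∂f/∂y(0,0) ≠ 0, and such that x ↦ f(x,0) has all derivatives of order ≤ k equal to 0 at x = 0 and nonzero derivative of order k+1 at x = 0. Then there exist a local diffeomorphism φ at 0 with φ(0) = 0 and smooth nonvanishing functions κ, λ near 0 such that a_D = κ·φ*(a_D) and f(p)·X_D(p) = λ(p)·(Dφ(p))⁻¹( ((y − x^{k+1})·X_D)(φ(p)) ) for all p near 0; that is, f·X_D is orbitally a_D-conjugate to (y − x^{k+1})·X_D. -/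

import Mathlib

noncomputable section

/-- The Darboux 1-form `a_D(x,y)(v) = (1+x)·v₂`. -/
def aD : ℝ × ℝ → ((ℝ × ℝ) →L[ℝ] ℝ) :=
  fun p => (1 + p.1) • ContinuousLinearMap.snd ℝ ℝ ℝ

/-- The vector field `X_D(x,y) = (−(1+x), 0)` spanning the kernel of the
Darboux 1-form. -/
def XD : ℝ × ℝ → ℝ × ℝ := fun p => (-(1 + p.1), 0)

open Set Filter Topology
open scoped ContDiff

/-- Differentiation under the integral sign for `C¹` integrands. -/
theorem hasFDerivAt_intervalIntegral_of_contDiff {H E : Type*} [NormedAddCommGroup H]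
    [NormedSpace ℝ H] [FiniteDimensional ℝ H] [NormedAddCommGroup E] [NormedSpace ℝ E]
    {F : H × ℝ → E} (hF : ContDiff ℝ 1 F) (a b : ℝ) (p : H) :
    HasFDerivAt (fun p => ∫ t in a..b, F (p, t))
      (∫ t in a..b, (fderiv ℝ F (p, t)).comp (ContinuousLinearMap.inl ℝ H ℝ)) p := by
  have hproper : ProperSpace H := FiniteDimensional.proper ℝ H
  have hcont : Continuous fun z : H × ℝ =>
      (fderiv ℝ F z).comp (ContinuousLinearMap.inl ℝ H ℝ) :=
    (hF.continuous_fderiv one_ne_zero).clm_comp continuous_const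
  obtain ⟨C, hC⟩ := ((isCompact_closedBall p 1).prod
    (isCompact_uIcc (a := a) (b := b))).exists_bound_of_continuousOn hcont.continuousOn
  refine intervalIntegral.hasFDerivAt_integral_of_dominated_of_fderiv_le
    (F' := fun q t => (fderiv ℝ F (q, t)).comp (ContinuousLinearMap.inl ℝ H ℝ))
    (bound := fun _ => C) (Metric.closedBall_mem_nhds p one_pos) ?_ ?_ ?_ ?_ ?_ ?_
  · exact Eventually.of_forall fun q =>
      (hF.continuous.comp (Continuous.prodMk_right q)).aestronglyMeasurable
  · exact (hF.continuous.comp (Continuous.prodMk_right p)).intervalIntegrable _ _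
  · exact (hcont.comp (Continuous.prodMk_right p)).aestronglyMeasurable
  · exact Eventually.of_forall fun t ht q hq => hC (q, t) ⟨hq, uIoc_subset_uIcc ht⟩
  · exact intervalIntegrable_const
  · refine Eventually.of_forall fun t _ q _ => ?_
    have h := ((hF.differentiable one_ne_zero) (q, t)).hasFDerivAt
    exact h.comp q (hasFDerivAt_prodMk_left q t)

theorem contDiff_nat_intervalIntegral.{u} {H : Type u} [NormedAddCommGroup H]
    [NormedSpace ℝ H] [FiniteDimensional ℝ H] (a b : ℝ) (n : ℕ) :
    ∀ {E : Type u} [NormedAddCommGroup E] [NormedSpace ℝ E] {F : H × ℝ → E},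
      ContDiff ℝ n F → ContDiff ℝ n (fun p => ∫ t in a..b, F (p, t)) := by
  induction n with
  | zero =>
    intro E _ _ F hF
    simp only [Nat.cast_zero, contDiff_zero] at hF ⊢
    exact intervalIntegral.continuous_parametric_intervalIntegral_of_continuous'
      (f := fun p t => F (p, t)) hF a b
  | succ n ih =>
    intro E _ _ F hF
    push_cast at hF ⊢
    refine contDiff_succ_iff_hasFDerivAt.2 ⟨_, ?_, fun p =>
      hasFDerivAt_intervalIntegral_of_contDiff (hF.of_le le_add_self) a b p⟩
    exact ih ((hF.fderiv_right le_rfl).clm_comp contDiff_const)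

/-- Hadamard's lemma with parameters. -/
theorem exists_contDiff_eq_add_snd_mul {P : Type} [NormedAddCommGroup P] [NormedSpace ℝ P]
    [FiniteDimensional ℝ P] {F : P × ℝ → ℝ} (hF : ContDiff ℝ ∞ F) :
    ∃ q : P × ℝ → ℝ, ContDiff ℝ ∞ q ∧ (∀ x y, F (x, y) = F (x, 0) + y * q (x, y)) ∧
      ∀ x, q (x, 0) = fderiv ℝ F (x, 0) (0, 1) := by
  have hF' : ContDiff ℝ ∞ fun z : (P × ℝ) × ℝ =>
      fderiv ℝ F (z.1.1, z.2 * z.1.2) (0, 1) :=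
    ((hF.fderiv_right (m := ∞) le_rfl).comp (by fun_prop)).clm_apply contDiff_const
  refine ⟨fun p => ∫ t in (0 : ℝ)..1, fderiv ℝ F (p.1, t * p.2) (0, 1),
    contDiff_infty.2 fun n => ?_, fun x y => ?_, fun x => by simp⟩
  · exact contDiff_nat_intervalIntegral 0 1 n (hF'.of_le (by exact_mod_cast le_top))
  · have hderiv : ∀ t : ℝ, HasDerivAt (fun t => F (x, t * y))
        (y * fderiv ℝ F (x, t * y) (0, 1)) t := fun t => by
      have hin : HasDerivAt (fun t : ℝ => (x, t * y)) ((0 : P), y) t :=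
        (hasDerivAt_const t x).prodMk (hasDerivAt_mul_const y)
      have h := ((hF.differentiable (by simp)) (x, t * y)).hasFDerivAt.comp_hasDerivAt t hin
      have hy : ((0 : P), y) = y • ((0 : P), (1 : ℝ)) := by simp
      rwa [hy, map_smul, smul_eq_mul] at h
    have hint := intervalIntegral.integral_eq_sub_of_hasDerivAt (a := 0) (b := 1)
      (fun t _ => hderiv t) <| Continuous.intervalIntegrable
        (continuous_const.mul (hF'.continuous.comp (Continuous.prodMk_right (x, y)))) _ _
    rw [intervalIntegral.integral_const_mul] at hint
    simp only [one_mul, zero_mul] at hint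
    rw [hint]; ring

theorem iteratedDeriv_succ_id_mul_zero {u : ℝ → ℝ} (hu : ContDiff ℝ ∞ u) (n : ℕ) :
    iteratedDeriv (n + 1) (fun x => x * u x) 0 = (n + 1) * iteratedDeriv n u 0 := by
  rw [iteratedDeriv_fun_mul (f := fun x => x) contDiffAt_id (hu.contDiffAt.of_le (by exact_mod_cast le_top)),
    Finset.sum_eq_single 1]
  · simp [iteratedDeriv_fun_id_zero]
  · intro i _ hi
    simp [iteratedDeriv_fun_id_zero, hi]
  · simp

theorem exists_contDiff_eq_pow_mul (m : ℕ) :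
    ∀ {g : ℝ → ℝ}, ContDiff ℝ ∞ g → (∀ n < m, iteratedDeriv n g 0 = 0) →
      iteratedDeriv m g 0 ≠ 0 → ∃ u : ℝ → ℝ, ContDiff ℝ ∞ u ∧ u 0 ≠ 0 ∧ ∀ x, g x = x ^ m * u x := by
  induction m with
  | zero => exact fun {g} hg _ h => ⟨g, hg, by simpa using h, by simp⟩
  | succ m ih =>
    intro g hg hlt hne
    obtain ⟨q, hq, hgq, -⟩ := exists_contDiff_eq_add_snd_mul (F := fun z : ℝ × ℝ => g z.2)
      (hg.comp contDiff_snd)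
    have hv : ContDiff ℝ ∞ fun x => q (0, x) := hq.comp (by fun_prop)
    have hg0 : g 0 = 0 := by simpa using hlt 0 m.succ_pos
    have hgv : g = fun x => x * q (0, x) := by
      ext x; simpa [hg0] using hgq 0 x
    have hder (n : ℕ) : iteratedDeriv (n + 1) g 0
        = (n + 1) * iteratedDeriv n (fun x => q (0, x)) 0 := by
      rw [hgv]; exact iteratedDeriv_succ_id_mul_zero hv n
    obtain ⟨u, hu, hu0, hvu⟩ := ih hv
      (fun n hn => by
        have h := hder n
        rw [hlt (n + 1) (by omega)] at h
        exact (mul_eq_zero.1 h.symm).resolve_left (by positivity))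
      (fun h => hne (by rw [hder, h, mul_zero]))
    exact ⟨u, hu, hu0, fun x => by rw [hgv]; simp only [hvu]; ring⟩

theorem exists_contDiff_eventuallyEq {E F : Type*} [NormedAddCommGroup E] [NormedSpace ℝ E]
    [FiniteDimensional ℝ E] [NormedAddCommGroup F] [NormedSpace ℝ F] {U : Set E} (hU : IsOpen U)
    {x : E} (hx : x ∈ U) {f : E → F} (hf : ContDiffOn ℝ ∞ f U) :
    ∃ g : E → F, ContDiff ℝ ∞ g ∧ g =ᶠ[𝓝 x] f := by
  obtain ⟨ε, hε, hsub⟩ := Metric.nhds_basis_closedBall.mem_iff.1 (hU.mem_nhds hx)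
  let b : ContDiffBump x := ⟨ε / 2, ε, by positivity, by linarith⟩
  refine ⟨fun y => b y • f y, contDiff_iff_contDiffAt.2 fun y => ?_, ?_⟩
  · by_cases hy : y ∈ U
    · exact b.contDiff.contDiffAt.smul (hf.contDiffAt (hU.mem_nhds hy))
    · have hy' : y ∉ tsupport b := fun h => hy (hsub (by rwa [b.tsupport_eq] at h))
      refine contDiffAt_const (c := 0) |>.congr_of_eventuallyEq ?_
      filter_upwards [notMem_tsupport_iff_eventuallyEq.1 hy'] with z hz
      simp [hz]
  · filter_upwards [b.eventuallyEq_one] with y hy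
    simp [hy]

/-- An endomorphism of the plane preserving the horizontal lines is invertible as soon as its
diagonal entries are nonzero, and its inverse divides horizontal vectors by the first entry. -/
theorem det_ne_zero_and_inverse_apply_of_snd_apply {L : ℝ × ℝ →L[ℝ] ℝ × ℝ} {s : ℝ} (hs : s ≠ 0)
    (hL : ∀ v, (L v).2 = s * v.2) (hL1 : (L (1, 0)).1 ≠ 0) :
    L.det ≠ 0 ∧ ∀ c, L.inverse (c, 0) = (c / (L (1, 0)).1, 0) := by
  have hhor (c : ℝ) : L (c, 0) = (c * (L (1, 0)).1, 0) := by
    have h : ((c, 0) : ℝ × ℝ) = c • (1, 0) := by simp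
    ext
    · rw [h, map_smul]; simp
    · simp [hL]
  have hinj : Function.Injective (L : ℝ × ℝ →ₗ[ℝ] ℝ × ℝ) := by
    refine (injective_iff_map_eq_zero _).2 fun ⟨v, w⟩ hv => ?_
    rw [ContinuousLinearMap.coe_coe] at hv
    have hw : w = 0 := by
      have h := hL (v, w)
      rw [hv] at h
      simpa [hs] using h.symm
    subst hw
    rw [hhor] at hv
    simpa [hL1] using congrArg Prod.fst hv
  let e := (LinearEquiv.ofInjectiveEndo _ hinj).toContinuousLinearEquiv
  have he : (e : ℝ × ℝ →L[ℝ] ℝ × ℝ) = L := by ext <;> rfl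
  refine ⟨?_, fun c => ?_⟩
  · exact (LinearEquiv.isUnit_det' (LinearEquiv.ofInjectiveEndo _ hinj)).ne_zero
  · rw [← he, ContinuousLinearMap.inverse_equiv, he]
    refine (e.symm_apply_eq).2 ?_
    change _ = L _
    rw [hhor, div_mul_cancel₀ _ hL1]

/-- If `f` is smooth near `0 ∈ ℝ²` with `f(0,0) = 0`, `∂f/∂y(0,0) ≠ 0`, and
`x ↦ f(x,0)` vanishes to order exactly `k+1` at `0`, then `f·X_D` is orbitally
`a_D`-conjugate to `(y − x^{k+1})·X_D`: there are a local diffeomorphism `φ`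
fixing `0` which is a conformal symmetry of `a_D` (`a_D = κ·φ*(a_D)`) and a
smooth nonvanishing `λ` with `f·X_D = λ·φ*((y − x^{k+1})·X_D)` near `0`. -/
theorem stmt_8 (k : ℕ) (U : Set (ℝ × ℝ)) (hUo : IsOpen U) (hU0 : (0 : ℝ × ℝ) ∈ U)
    (f : ℝ × ℝ → ℝ) (hf : ContDiffOn ℝ (⊤ : ℕ∞) f U)
    (hf0 : f 0 = 0) (hfy : fderiv ℝ f 0 (0, 1) ≠ 0)
    (hflat : ∀ n ≤ k, iteratedDeriv n (fun x : ℝ => f (x, 0)) 0 = 0)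
    (hnonflat : iteratedDeriv (k + 1) (fun x : ℝ => f (x, 0)) 0 ≠ 0) :
    ∃ (φ : ℝ × ℝ → ℝ × ℝ) (W : Set (ℝ × ℝ)) (κ lam : ℝ × ℝ → ℝ),
      IsOpen W ∧ (0 : ℝ × ℝ) ∈ W ∧ φ 0 = 0 ∧
      ContDiffOn ℝ (⊤ : ℕ∞) φ W ∧ (∀ p ∈ W, (fderiv ℝ φ p).det ≠ 0) ∧
      ContDiffOn ℝ (⊤ : ℕ∞) κ W ∧ (∀ p ∈ W, κ p ≠ 0) ∧
      ContDiffOn ℝ (⊤ : ℕ∞) lam W ∧ (∀ p ∈ W, lam p ≠ 0) ∧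
      -- a_D = κ·φ*(a_D)
      (∀ p ∈ W, aD p = κ p • ((aD (φ p)).comp (fderiv ℝ φ p))) ∧
      -- f·X_D = λ·φ*((y − x^{k+1})·X_D)
      (∀ p ∈ W, f p • XD p =
        lam p • (fderiv ℝ φ p).inverse
          (((φ p).2 - (φ p).1 ^ (k + 1)) • XD (φ p))) := by
  obtain ⟨F, hF, hFf⟩ := exists_contDiff_eventuallyEq hUo hU0 hf
  have hslice : (fun x : ℝ => F (x, 0)) =ᶠ[𝓝 0] fun x => f (x, 0) :=
    (Continuous.prodMk_left (0 : ℝ)).tendsto' (0 : ℝ) (0 : ℝ × ℝ) rfl |>.eventually hFf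
  obtain ⟨q, hq, hFq, hq0⟩ := exists_contDiff_eq_add_snd_mul hF
  obtain ⟨u, hu, hu0, hFu⟩ := exists_contDiff_eq_pow_mul (k + 1)
    (g := fun x => F (x, 0)) (hF.comp (by fun_prop))
    (fun n hn => by rw [hslice.iteratedDeriv_eq n]; exact hflat n (by omega))
    (by rwa [hslice.iteratedDeriv_eq])
  have hq0' : q 0 ≠ 0 := by
    have h := hq0 0
    rw [Prod.mk_zero_zero, hFf.fderiv_eq] at h
    rwa [h]
  obtain ⟨s, hs, hsu⟩ : ∃ s : ℝ, s * s = 1 ∧ 0 < -s * u 0 * q 0 := by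
    rcases (mul_ne_zero hu0 hq0').lt_or_gt with h | h
    · exact ⟨1, by norm_num, by linarith⟩
    · exact ⟨-1, by norm_num, by linarith⟩
  have hs0 : s ≠ 0 := left_ne_zero_of_mul (hs.trans_ne one_ne_zero)
  let W₀ : Set (ℝ × ℝ) := {p | 0 < -s * u p.1 * q p}
  have hW₀ : IsOpen W₀ := isOpen_lt continuous_const
    ((continuous_const.mul (hu.continuous.comp continuous_fst)).mul hq.continuous)
  have h0W₀ : (0 : ℝ × ℝ) ∈ W₀ := hsu
  have hqW {p} (hp : p ∈ W₀) : q p ≠ 0 := right_ne_zero_of_mul (ne_of_gt hp)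
  have hpos {p} (hp : p ∈ W₀) : 0 < -s * u p.1 / q p := by
    have h : -s * u p.1 / q p = (-s * u p.1 * q p) / (q p) ^ 2 := by
      field_simp [hqW hp]
    rw [h]
    exact div_pos hp (sq_pos_of_ne_zero (hqW hp))
  let R : ℝ × ℝ → ℝ := fun p => (-s * u p.1 / q p) ^ (((k + 1 : ℕ) : ℝ)⁻¹)
  have hR : ContDiffOn ℝ ∞ R W₀ := by
    refine ContDiffOn.rpow_const_of_ne ?_ fun p hp => (hpos hp).ne'
    exact ((contDiff_const.mul (hu.comp contDiff_fst)).contDiffOn).div hq.contDiffOn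
      fun p hp => hqW hp
  have hRpow {p} (hp : p ∈ W₀) : R p ^ (k + 1) = -s * u p.1 / q p :=
    Real.rpow_inv_natCast_pow (hpos hp).le k.succ_ne_zero
  let Φ : ℝ × ℝ → ℝ := fun p => p.1 * R p
  have hΦ : ContDiffOn ℝ ∞ Φ W₀ := contDiff_fst.contDiffOn.mul hR
  let Φx : ℝ × ℝ → ℝ := fun p => fderiv ℝ Φ p (1, 0)
  have hΦx : ContDiffOn ℝ ∞ Φx W₀ :=
    (hΦ.fderiv_of_isOpen hW₀ le_rfl).clm_apply contDiffOn_const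
  have hW₀mem := hW₀.mem_nhds h0W₀
  have hΦ0 : Φ 0 = 0 := by simp [Φ]
  have hΦx0 : Φx 0 ≠ 0 := by
    have h : HasFDerivAt Φ _ 0 := hasFDerivAt_fst.mul
      (((hR.contDiffAt hW₀mem).differentiableAt (by simp)).hasFDerivAt)
    have hR0 : R 0 ≠ 0 := (Real.rpow_pos_of_pos (hpos h0W₀) _).ne'
    simpa [Φx, h.fderiv] using hR0
  have hev : ∀ᶠ p in 𝓝 (0 : ℝ × ℝ),
      p ∈ W₀ ∧ F p = f p ∧ Φx p ≠ 0 ∧ 1 + Φ p ≠ 0 ∧ 1 + p.1 ≠ 0 := by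
    refine (Filter.eventually_of_mem hW₀mem fun _ h => h).and <| hFf.and <|
      ((hΦx.continuousOn.continuousAt hW₀mem).eventually_ne hΦx0).and <|
      (((hΦ.continuousOn.continuousAt hW₀mem).const_add 1).eventually_ne (by simp [hΦ0])).and ?_
    exact (continuous_const.add continuous_fst).continuousAt.eventually_ne (by simp)
  obtain ⟨W, hW, hWo, h0W⟩ := eventually_nhds_iff.1 hev
  have hWsub : W ⊆ W₀ := fun p hp => (hW p hp).1
  have hφ : ContDiffOn ℝ ∞ (fun p : ℝ × ℝ => (Φ p, s * p.2)) W :=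
    (hΦ.mono hWsub).prodMk (contDiff_const.mul contDiff_snd).contDiffOn
  have hfd {p} (hp : p ∈ W) : fderiv ℝ (fun p : ℝ × ℝ => (Φ p, s * p.2)) p
      = (fderiv ℝ Φ p).prod (s • ContinuousLinearMap.snd ℝ ℝ ℝ) := by
    have hd := (hΦ.contDiffAt (hW₀.mem_nhds (hWsub hp))).differentiableAt (by simp)
    exact (hd.hasFDerivAt.prodMk (hasFDerivAt_snd.const_mul s)).fderiv
  have hinv {p} (hp : p ∈ W) := det_ne_zero_and_inverse_apply_of_snd_apply
    (L := (fderiv ℝ Φ p).prod (s • ContinuousLinearMap.snd ℝ ℝ ℝ)) hs0 (fun v => by simp)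
    (hW p hp).2.2.1
  have hΦW : ContDiffOn ℝ ∞ (fun p => 1 + Φ p) W := contDiffOn_const.add (hΦ.mono hWsub)
  have hxW : ContDiffOn ℝ ∞ (fun p : ℝ × ℝ => 1 + p.1) W :=
    (contDiff_const.add contDiff_fst).contDiffOn
  refine ⟨fun p => (Φ p, s * p.2), W, fun p => s * (1 + p.1) / (1 + Φ p),
    fun p => q p * s * (1 + p.1) * Φx p / (1 + Φ p), hWo, h0W, by simp [hΦ0], hφ,
    fun p hp => ?_, ?_, fun p hp => ?_, ?_, fun p hp => ?_, fun p hp => ?_, fun p hp => ?_⟩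
  · rw [hfd hp]; exact (hinv hp).1
  · exact (contDiffOn_const.mul hxW).div hΦW fun p hp => (hW p hp).2.2.2.1
  · obtain ⟨-, -, -, h1, h2⟩ := hW p hp
    exact div_ne_zero (mul_ne_zero hs0 h2) h1
  · exact (((hq.contDiffOn.mul contDiffOn_const).mul hxW).mul (hΦx.mono hWsub)).div hΦW
      fun p hp => (hW p hp).2.2.2.1
  · obtain ⟨h0, -, h3, h1, h2⟩ := hW p hp
    exact div_ne_zero (mul_ne_zero (mul_ne_zero (mul_ne_zero (hqW h0) hs0) h2) h3) h1
  · have h1 := (hW p hp).2.2.2.1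
    rw [hfd hp]
    ext
    · simp [aD]
    · simp only [aD, ContinuousLinearMap.comp_apply, ContinuousLinearMap.inr_apply,
        smul_apply, ContinuousLinearMap.prod_apply,
        ContinuousLinearMap.coe_snd', smul_eq_mul]
      field_simp
      linear_combination (-(1 + p.1)) * hs
  · obtain ⟨h0, hfF, h3, h1, -⟩ := hW p hp
    have hq := hqW h0
    have hfp : f p = q p * s * (s * p.2 - Φ p ^ (k + 1)) := by
      have hpow : Φ p ^ (k + 1) = p.1 ^ (k + 1) * (-s * u p.1 / q p) := by
        rw [← hRpow h0, ← mul_pow]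
      rw [← hfF, hpow, show F p = F (p.1, p.2) from rfl, hFq, hFu p.1]
      field_simp
      linear_combination (-(p.2 * q p + p.1 ^ (k + 1) * u p.1)) * hs
    have hvec : (s * p.2 - Φ p ^ (k + 1)) • XD (Φ p, s * p.2)
        = ((s * p.2 - Φ p ^ (k + 1)) * -(1 + Φ p), 0) := by simp [XD]
    rw [hfd hp]
    dsimp only
    rw [hvec, (hinv hp).2, hfp]
    change _ = _ • (_ / Φx p, (0 : ℝ))
    ext
    · simp only [XD, Prod.smul_fst, smul_eq_mul]
      field_simp
    · simp [XD]
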